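/- arXiv:2005.12239 — 8 statements merged into one kernel-verified Lean document; each statement's English description precedes it below -/
import Mathlib

section
/- Let m and r be coprime integers with 2 ≤ r ≤ m−1, set g = (m−1)(r−1)/2, and let n and b be natural numbers with n > 2g−1, n ≡ r−1 (mod m), and b ≤ n. Write ρ = b mod m (the unique integer in {0,…,m−1} congruent to b modulo m). Then the set S(m,r,n,b) is nonempty and its greatest element equals n+2g−b+ρ−r−r·ρ if ρ ≤ ⌊m/r⌋−1, and equals n+2g−b+ρ−m if ρ ≥ ⌊m/r⌋. -/
/-- The arithmetic jump set `S(m,r,n,b)` from Theorem 6.1 of the paper: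
`a ∈ S(m,r,n,b)` iff either `a+b < n` and `(r-1)·((r̃·a) mod m) ≤ a+b`, or
`n ≤ a+b ≤ n+2g-1` and `(r-1)·((r̃·(a-n-1)) mod m) > a+b-n`.
Here `rt` is the inverse of `r` modulo `m` and `g = (m-1)(r-1)/2`. -/
def S (m r rt g n b : ℕ) : Set ℕ :=
  {a : ℕ |
    ((a : ℤ) + b < n ∧ ((r : ℤ) - 1) * (((rt : ℤ) * a) % m) ≤ (a : ℤ) + b) ∨
    ((n : ℤ) ≤ (a : ℤ) + b ∧ (a : ℤ) + b ≤ (n : ℤ) + 2 * g - 1 ∧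
      (a : ℤ) + b - n < ((r : ℤ) - 1) * (((rt : ℤ) * ((a : ℤ) - n - 1)) % m))}

/-- If `r * s ≡ 1 [ZMOD m]`, an integer `z` is `r` times the residue of `s * z`, modulo `m`. -/
lemma exists_eq_mul_emod_add {m r s : ℤ} (h : r * s % m = 1) (z : ℤ) :
    ∃ k, z = r * (s * z % m) + m * k := by
  have h1 := Int.emod_add_mul_ediv (r * s) m
  have h2 := Int.emod_add_mul_ediv (s * z) m
  rw [h] at h1
  exact ⟨r * (s * z / m) - z * (r * s / m), by linear_combination (-r) * h2 + z * h1⟩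

/-- If `r * s ≡ 1 [ZMOD m]` and `0 ≤ t < m`, then `t` is the residue of `s * (r * t + m * k)`. -/
lemma mul_emod_eq_of_inverse {m r s t : ℤ} (h : r * s % m = 1) (ht : 0 ≤ t) (htm : t < m)
    (k : ℤ) : s * (r * t + m * k) % m = t := by
  have h1 := Int.emod_add_mul_ediv (r * s) m
  rw [h] at h1
  rw [show s * (r * t + m * k) = t + m * (t * (r * s / m) + s * k) by
    linear_combination (-t) * h1, Int.add_mul_emod_self_left, Int.emod_eq_of_lt ht htm]

/-- Bound on `c = r * t + ρ + 1 + m * k` when `c < (r - 1) * t` and `0 ≤ t < m`. -/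
lemma le_or_le_of_lt_mul {m r t ρ c k : ℤ} (hr : 2 ≤ r) (ht : 0 ≤ t) (htm : t < m)
    (hρ : 0 ≤ ρ) (hc : c = r * t + ρ + 1 + m * k) (hlt : c < (r - 1) * t) :
    c ≤ (m - 1) * (r - 1) + ρ - r - r * ρ ∨ c ≤ (m - 1) * (r - 1) + ρ - m := by
  have hneg : t + ρ + 1 + m * k < 0 := by linarith
  have hk : k < 0 := by
    by_contra! hk
    nlinarith
  obtain rfl | hk' : k = -1 ∨ k ≤ -2 := by omega
  · left
    nlinarith [mul_nonneg (by linarith : 0 ≤ r) (by linarith : 0 ≤ m - ρ - 2 - t)]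
  · right
    nlinarith [mul_nonneg (by linarith : 0 ≤ m) (by linarith : 0 ≤ -2 - k),
      mul_nonneg (by linarith : 0 ≤ r) (by linarith : 0 ≤ m - 1 - t)]

/-- Criterion for `n + c - b` to be the greatest element of `S`, where `c = r * t + ρ + 1 + m * k`
and `ρ = b % m`. -/
lemma exists_isGreatest_S {m r rt g n b : ℕ} (hr2 : 2 ≤ r) (hrtinv : (r * rt) % m = 1)
    (hg : 2 * (g : ℤ) = (m - 1) * (r - 1)) (hb : b ≤ n) {c t k : ℤ}
    (hc0 : 0 ≤ c) (hcg : c < 2 * g) (ht : 0 ≤ t) (htm : t < m)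
    (hc : c = r * t + ((b % m : ℕ) : ℤ) + 1 + m * k) (hlt : c < (r - 1) * t)
    (hc₁ : 2 * (g : ℤ) + ((b % m : ℕ) : ℤ) - r - r * ((b % m : ℕ) : ℤ) ≤ c)
    (hc₂ : 2 * (g : ℤ) + ((b % m : ℕ) : ℤ) - m ≤ c) :
    ∃ a : ℕ, IsGreatest (S m r rt g n b) a ∧ (a : ℤ) = n + c - b := by
  have hinv : (r : ℤ) * rt % m = 1 := by exact_mod_cast hrtinv
  have hbm : ((b % m : ℕ) : ℤ) + m * (b / m : ℕ) = b := by exact_mod_cast Nat.mod_add_div b m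
  have hρ : (0 : ℤ) ≤ (b % m : ℕ) := by positivity
  obtain ⟨a, ha⟩ := Int.eq_ofNat_of_zero_le (show 0 ≤ (n : ℤ) + c - b by omega)
  refine ⟨a, ⟨Or.inr ⟨by omega, by omega, ?_⟩, ?_⟩, ha.symm⟩
  · rw [show (a : ℤ) - n - 1 = r * t + m * (k - (b / m : ℕ)) by linarith,
      mul_emod_eq_of_inverse hinv ht htm]
    linarith
  · rintro x (⟨hx, -⟩ | ⟨-, -, hx⟩)
    · omega
    · obtain ⟨l, hl⟩ := exists_eq_mul_emod_add hinv ((x : ℤ) - n - 1)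
      have hm : (0 : ℤ) < m := by linarith
      have := le_or_le_of_lt_mul (k := l + (b / m : ℕ)) (by exact_mod_cast hr2)
        (Int.emod_nonneg _ hm.ne') (Int.emod_lt_of_pos _ hm) hρ (by linarith) hx
      omega

/-- Proposition 6.2: with `ρ = b mod m`, the set `S(m,r,n,b)` has a greatest
element, equal to `n+2g-b+ρ-r-rρ` if `ρ ≤ ⌊m/r⌋-1`, and to `n+2g-b+ρ-m`
if `ρ ≥ ⌊m/r⌋`. -/
theorem stmt0 (m r rt g n b : ℕ)
    (hr2 : 2 ≤ r) (hrm : r ≤ m - 1) (hco : Nat.Coprime m r)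
    (hg : 2 * g = (m - 1) * (r - 1))
    (hrt1 : 1 ≤ rt) (hrt2 : rt ≤ m - 1) (hrtinv : (r * rt) % m = 1)
    (hn : 2 * (g : ℤ) - 1 < (n : ℤ)) (hnm : n % m = (r - 1) % m) (hb : b ≤ n) :
    ∃ a : ℕ, IsGreatest (S m r rt g n b) a ∧
      (b % m < m / r →
        (a : ℤ) = (n : ℤ) + 2 * g - b + ((b % m : ℕ) : ℤ) - r - r * ((b % m : ℕ) : ℤ)) ∧
      (m / r ≤ b % m →
        (a : ℤ) = (n : ℤ) + 2 * g - b + ((b % m : ℕ) : ℤ) - m) := by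
  have hm : 3 ≤ m := by omega
  have hg' : 2 * (g : ℤ) = (m - 1) * (r - 1) := by
    have := congrArg (Nat.cast : ℕ → ℤ) hg
    push_cast [Nat.cast_sub (show 1 ≤ m by omega), Nat.cast_sub (show 1 ≤ r by omega)] at this
    exact this
  have hr2' : (2 : ℤ) ≤ r := by exact_mod_cast hr2
  have hm' : (3 : ℤ) ≤ m := by exact_mod_cast hm
  have hρ : (0 : ℤ) ≤ (b % m : ℕ) := by positivity
  have hρm : ((b % m : ℕ) : ℤ) < m := by exact_mod_cast Nat.mod_lt b (by omega)
  have hiff : b % m < m / r ↔ (((b % m : ℕ) : ℤ) + 1) * r ≤ m := by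
    rw [← Nat.succ_le_iff, Nat.le_div_iff_mul_le (by omega)]
    exact_mod_cast Iff.rfl
  have hnonneg : 0 ≤ ((m : ℤ) - 2) * (r - 2) := mul_nonneg (by linarith) (by linarith)
  rcases lt_or_ge (b % m) (m / r) with h | h
  · have h' := hiff.1 h
    generalize hρdef : ((b % m : ℕ) : ℤ) = ρ at *
    have hmr : ρ + 2 ≤ m := by nlinarith
    obtain ⟨a, ha, hac⟩ := exists_isGreatest_S (c := 2 * g + ρ - r - r * ρ) (t := m - ρ - 2)
      (k := -1) hr2 hrtinv hg' hb (by
        rcases hρ.eq_or_lt with h0 | h0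
        · subst h0
          nlinarith
        · nlinarith) (by nlinarith) (by linarith) (by linarith)
      (by rw [hρdef]; linarith) (by linarith) (by rw [hρdef]) (by rw [hρdef]; linarith)
    exact ⟨a, ha, fun _ => by linarith, fun h₂ => absurd h h₂.not_gt⟩
  · have h' := not_le.1 (mt hiff.2 h.not_gt)
    have hpos : 0 < b % m := (Nat.div_pos (by omega) (by omega)).trans_le h
    have hpos' : (0 : ℤ) < (b % m : ℕ) := by exact_mod_cast hpos
    generalize hρdef : ((b % m : ℕ) : ℤ) = ρ at *
    obtain ⟨a, ha, hac⟩ := exists_isGreatest_S (c := 2 * g + ρ - m) (t := m - 1)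
      (k := -2) hr2 hrtinv hg' hb (by linarith) (by linarith) (by linarith) (by linarith)
      (by rw [hρdef]; linarith) (by linarith) (by rw [hρdef]; linarith) (by rw [hρdef])
    exact ⟨a, ha, fun h₂ => absurd h h₂.not_ge, fun _ => by linarith⟩
end

section
/- Let m and r be coprime integers with 2 ≤ r ≤ m−1, set g = (m−1)(r−1)/2, and let n be a natural number with n > 2g−1 and n ≡ r−1 (mod m). Then for every natural number b with 2b ≤ n−2g−2, the number n+2g−1−2b belongs to S(m,r,n,2b) if and only if m divides 2b+1. -/
/-- For `0 < k`, the multiple `k * (x % m)` exceeds `(m - 1) * k - 1` exactly when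
`x ≡ -1 [ZMOD m]`. -/
lemma sub_one_lt_mul_emod_iff {m k : ℤ} (hm : 0 < m) (hk : 0 < k) (x : ℤ) :
    (m - 1) * k - 1 < k * (x % m) ↔ m ∣ x + 1 := by
  have h0 := Int.emod_nonneg x hm.ne'
  have h1 := Int.emod_lt_of_pos x hm
  have hx := Int.emod_add_mul_ediv x m
  constructor
  · intro h
    have h2 : m - 1 ≤ x % m := by
      by_contra! hlt
      nlinarith
    exact ⟨x / m + 1, by linarith⟩
  · rintro ⟨c, hc⟩
    have h2 : m ∣ x % m + 1 := ⟨c - x / m, by linarith⟩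
    have h3 := Int.le_of_dvd (by omega) h2
    nlinarith

/-- If `s` is an inverse of `r` modulo `m`, then `s * c ≡ -1` exactly when `c ≡ -r`. -/
lemma dvd_inverse_mul_add_one_iff {m r s : ℤ} (hs : m ∣ r * s - 1) (c : ℤ) :
    m ∣ s * c + 1 ↔ m ∣ c + r := by
  obtain ⟨q, hq⟩ := hs
  constructor
  · rintro ⟨d, hd⟩
    exact ⟨r * d - q * c, by linear_combination r * hd - c * hq⟩
  · rintro ⟨d, hd⟩
    exact ⟨s * d - q, by linear_combination s * hd - hq⟩

/-- For every natural number `b` with `2b ≤ n-2g-2`, the number `n+2g-1-2b`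
belongs to `S(m,r,n,2b)` if and only if `m` divides `2b+1`. -/
theorem stmt1 (m r rt g n : ℕ)
    (hr2 : 2 ≤ r) (hrm : r ≤ m - 1) (hco : Nat.Coprime m r)
    (hg : 2 * g = (m - 1) * (r - 1))
    (hrt1 : 1 ≤ rt) (hrt2 : rt ≤ m - 1) (hrtinv : (r * rt) % m = 1)
    (hn : 2 * (g : ℤ) - 1 < (n : ℤ)) (hnm : n % m = (r - 1) % m) :
    ∀ b : ℕ, 2 * (b : ℤ) ≤ (n : ℤ) - 2 * g - 2 →
      (n + 2 * g - 1 - 2 * b ∈ S m r rt g n (2 * b) ↔ m ∣ 2 * b + 1) := by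
  intro b hb
  have hm : (0 : ℤ) < m := by omega
  have hr : (0 : ℤ) < (r : ℤ) - 1 := by omega
  have hgz : 2 * (g : ℤ) = ((m : ℤ) - 1) * ((r : ℤ) - 1) := by
    have h := congrArg (Nat.cast : ℕ → ℤ) hg
    push_cast [Nat.cast_sub (show 1 ≤ m by omega), Nat.cast_sub (show 1 ≤ r by omega)] at h
    exact h
  have hgpos : 0 < g := by
    have : 0 < (m - 1) * (r - 1) := Nat.mul_pos (by omega) (by omega)
    omega
  have hinv : (m : ℤ) ∣ (r : ℤ) * rt - 1 := by
    refine ⟨((r * rt / m : ℕ) : ℤ), ?_⟩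
    have h := Nat.mod_add_div (r * rt) m
    rw [hrtinv] at h
    have h' := congrArg (Nat.cast : ℕ → ℤ) h
    push_cast at h' ⊢
    linarith
  have ha : ((n + 2 * g - 1 - 2 * b : ℕ) : ℤ) = (n : ℤ) + 2 * g - 1 - 2 * b := by omega
  have hmem : n + 2 * g - 1 - 2 * b ∈ S m r rt g n (2 * b) ↔
      ((m : ℤ) - 1) * ((r : ℤ) - 1) - 1 <
        ((r : ℤ) - 1) * (((rt : ℤ) * (2 * g - 2 - 2 * b)) % m) := by
    simp only [S, Set.mem_ofPred_eq, ha, ← hgz]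
    push_cast
    rw [show (n : ℤ) + 2 * g - 1 - 2 * b - n - 1 = 2 * g - 2 - 2 * b by ring]
    omega
  rw [hmem, sub_one_lt_mul_emod_iff hm hr, dvd_inverse_mul_add_one_iff hinv,
    ← Int.natCast_dvd_natCast,
    show (2 * (g : ℤ) - 2 - 2 * b + r) = m * ((r : ℤ) - 1) - ((2 * b + 1 : ℕ) : ℤ) by
      push_cast; linear_combination hgz]
  exact dvd_sub_right (dvd_mul_right _ _)
end

section
/- Let q ≥ 2 be an integer and let b be an integer with 0 ≤ b ≤ q. Then S(q+1, q, q³−1, b) = T(q,b); that is, the arithmetic jump set of Theorem 6.1 specialized to the Hermitian parameters m = q+1, r = q, n = q³−1 coincides with the Homma–Kim description of the two-point Hermitian jump set. -/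
/-- The Homma–Kim description (Equation (3) of the paper) of the jump set
`H_b^*` for two-point Hermitian codes of length `q³-1`:
`T(q,b) = { qθ+ρ : 0 ≤ ρ ≤ q-2, ρ ≤ θ ≤ ρ+q²-1 }
        ∪ { qθ+(q-1) : q-b-1 ≤ θ ≤ q²+q-b-3 }`. -/
def T (q b : ℕ) : Set ℕ :=
  {x : ℕ | ∃ θ ρ : ℕ, (ρ : ℤ) ≤ (q : ℤ) - 2 ∧ ρ ≤ θ ∧
      (θ : ℤ) ≤ (ρ : ℤ) + (q : ℤ) ^ 2 - 1 ∧ x = q * θ + ρ} ∪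
  {x : ℕ | ∃ θ : ℕ, (q : ℤ) - b - 1 ≤ (θ : ℤ) ∧
      (θ : ℤ) ≤ (q : ℤ) ^ 2 + q - b - 3 ∧ x = q * θ + (q - 1)}

/-- The gap inequality of the first kind, at `a = qθ + ρ`, is a lower bound on `θ`. -/
theorem sub_one_mul_emod_le_iff {q b t r : ℤ} (hq : 2 ≤ q) (hb0 : 0 ≤ b) (hb : b ≤ q)
    (ht : 0 ≤ t) (hr0 : 0 ≤ r) (hr : r < q) :
    (q - 1) * ((q * (q * t + r)) % (q + 1)) ≤ q * t + r + b ↔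
      (r ≤ q - 2 ∧ r ≤ t) ∨ (r = q - 1 ∧ q - b - 1 ≤ t) := by
  have e : (q * (q * t + r)) % (q + 1) = (t - r) % (q + 1) :=
    (Int.modEq_iff_dvd.2 ⟨(q - 1) * t + r, by ring⟩ : t - r ≡ _ [ZMOD q + 1]).symm
  rw [e]
  have h0 := Int.emod_nonneg (t - r) (by lia : q + 1 ≠ 0)
  have h1 := Int.emod_lt_of_pos (t - r) (by lia : 0 < q + 1)
  have h2 := Int.emod_add_mul_ediv (t - r) (q + 1)
  generalize (t - r) % (q + 1) = s at *
  generalize (t - r) / (q + 1) = k at *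
  obtain rfl : t = r + s + (q + 1) * k := by lia
  have key : (q - 1) * s ≤ q * (r + s + (q + 1) * k) + r + b ↔
      0 ≤ (q + 1) * (r + q * k) + s + b := by
    constructor <;> intro h <;> linarith
  rw [key]
  rcases lt_or_ge k 0 with hk | hk
  · have hk1 : k = -1 := by
      by_contra hne
      have : (q + 1) * k ≤ (q + 1) * (-2) := by
        apply mul_le_mul_of_nonneg_left <;> lia
      lia
    subst hk1
    rcases lt_or_ge r (q - 1) with h | h
    · have : (q + 1) * (r + q * -1) ≤ (q + 1) * (-2) := by
        apply mul_le_mul_of_nonneg_left <;> lia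
      constructor <;> intro <;> lia
    · obtain rfl : r = q - 1 := by lia
      have : (q + 1) * (q - 1 + q * -1) = -(q + 1) := by ring
      constructor <;> intro <;> lia
  · have hA : 0 ≤ (q + 1) * (r + q * k) := by positivity
    have hB : 0 ≤ (q + 1) * k := by positivity
    constructor <;> intro <;> lia

/-- The gap inequality of the second kind, at `a = qθ + ρ`, is an upper bound on `θ`. -/
theorem lt_sub_one_mul_emod_iff {q b t r : ℤ} (hq : 2 ≤ q) (hb0 : 0 ≤ b) (hb : b ≤ q)
    (hr0 : 0 ≤ r) (hr : r < q) :
    q * t + r + b - (q ^ 3 - 1) <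
        (q - 1) * ((q * (q * t + r - (q ^ 3 - 1) - 1)) % (q + 1)) ↔
      (r ≤ q - 2 ∧ t ≤ r + q ^ 2 - 1) ∨ (r = q - 1 ∧ t ≤ q ^ 2 + q - b - 3) := by
  have e : (q * (q * t + r - (q ^ 3 - 1) - 1)) % (q + 1) = (t - r - 1) % (q + 1) :=
    (Int.modEq_iff_dvd.2 ⟨(q - 1) * t + r - (q - 1) * (q ^ 2 + 1), by ring⟩ :
      t - r - 1 ≡ _ [ZMOD q + 1]).symm
  rw [e]
  have h0 := Int.emod_nonneg (t - r - 1) (by lia : q + 1 ≠ 0)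
  have h1 := Int.emod_lt_of_pos (t - r - 1) (by lia : 0 < q + 1)
  have h2 := Int.emod_add_mul_ediv (t - r - 1) (q + 1)
  generalize (t - r - 1) % (q + 1) = s at *
  generalize (t - r - 1) / (q + 1) = k at *
  obtain ⟨j, rfl⟩ : ∃ j, k = q - 2 + j := ⟨k - (q - 2), by ring⟩
  obtain rfl : t = r + 1 + s + (q + 1) * (q - 2 + j) := by lia
  have key : q * (r + 1 + s + (q + 1) * (q - 2 + j)) + r + b - (q ^ 3 - 1) < (q - 1) * s ↔
      (q + 1) * (r + 1 - q + q * j) + s + b < q := by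
    constructor <;> intro h <;> linarith
  have eU : (q + 1) * (q - 2 + j) = q ^ 2 - q - 2 + (q + 1) * j := by ring
  rw [key, eU]
  generalize q ^ 2 = Q
  rcases lt_trichotomy j 0 with hj | rfl | hj
  · have hA : (q + 1) * j ≤ (q + 1) * (-1) := by
      apply mul_le_mul_of_nonneg_left <;> lia
    have hB : q * j ≤ q * (-1) := by
      apply mul_le_mul_of_nonneg_left <;> lia
    have hC : (q + 1) * (r + 1 - q + q * j) ≤ (q + 1) * (-1 * q) := by
      apply mul_le_mul_of_nonneg_left <;> lia
    have hD : (q + 1) * 2 ≤ (q + 1) * q := by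
      apply mul_le_mul_of_nonneg_left <;> lia
    constructor <;> intro <;> lia
  · rcases lt_or_ge r (q - 1) with h | h
    · have : (q + 1) * (r + 1 - q + q * 0) ≤ (q + 1) * (-1) := by
        apply mul_le_mul_of_nonneg_left <;> lia
      constructor <;> intro <;> lia
    · obtain rfl : r = q - 1 := by lia
      have : (q + 1) * (q - 1 + 1 - q + q * 0) = 0 := by ring
      constructor <;> intro <;> lia
  · have hA : (q + 1) * 1 ≤ (q + 1) * j := by
      apply mul_le_mul_of_nonneg_left <;> lia
    have hB : q * 1 ≤ q * j := by
      apply mul_le_mul_of_nonneg_left <;> lia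
    have hC : (q + 1) * 1 ≤ (q + 1) * (r + 1 - q + q * j) := by
      apply mul_le_mul_of_nonneg_left <;> lia
    constructor <;> intro <;> lia

/-- For Hermitian parameters, lying in `S` means satisfying both gap inequalities at once. -/
theorem mem_S_hermitian_iff {q b a : ℕ} (hq : 2 ≤ q) :
    a ∈ S (q + 1) q q (q * (q - 1) / 2) (q ^ 3 - 1) b ↔
      ((q : ℤ) - 1) * (((q : ℤ) * a) % (q + 1)) ≤ a + b ∧
      (a : ℤ) + b - (q ^ 3 - 1) <
        ((q : ℤ) - 1) * (((q : ℤ) * (a - (q ^ 3 - 1) - 1)) % (q + 1)) := by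
  have hn : ((q ^ 3 - 1 : ℕ) : ℤ) = (q : ℤ) ^ 3 - 1 := by
    rw [Nat.cast_sub (Nat.one_le_pow _ _ (by lia))]; push_cast; rfl
  have hg : 2 * ((q * (q - 1) / 2 : ℕ) : ℤ) = ((q : ℤ) - 1) * q := by
    have h : 2 * (q * (q - 1) / 2) = q * (q - 1) :=
      Nat.mul_div_cancel' (Nat.even_mul_pred_self q).two_dvd
    have h' : ((2 * (q * (q - 1) / 2) : ℕ) : ℤ) = ((q * (q - 1) : ℕ) : ℤ) := by rw [h]
    rw [Nat.cast_mul, Nat.cast_mul, Nat.cast_sub (by lia : 1 ≤ q)] at h'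
    push_cast at h' ⊢
    linarith
  simp only [S, Set.mem_ofPred_eq, hn, hg, Nat.cast_add, Nat.cast_one]
  have hq' : (2 : ℤ) ≤ q := by exact_mod_cast hq
  have bound (z : ℤ) : 0 ≤ ((q : ℤ) - 1) * (z % (q + 1)) ∧
      ((q : ℤ) - 1) * (z % (q + 1)) ≤ ((q : ℤ) - 1) * q := by
    have h0 := Int.emod_nonneg z (by lia : (q : ℤ) + 1 ≠ 0)
    have h1 := Int.emod_lt_of_pos z (by lia : 0 < (q : ℤ) + 1)
    exact ⟨mul_nonneg (by lia) h0, mul_le_mul_of_nonneg_left (by lia) (by lia)⟩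
  have b1 := bound (q * a)
  have b2 := bound (q * (a - (q ^ 3 - 1) - 1))
  have hbig : ((q : ℤ) - 1) * q ≤ q ^ 3 - 1 := by
    nlinarith [mul_nonneg (by lia : (0 : ℤ) ≤ q - 1) (by positivity : (0 : ℤ) ≤ (q : ℤ) ^ 2)]
  constructor
  · rintro (⟨h1, h2⟩ | ⟨h1, h2, h3⟩)
    · exact ⟨h2, by linarith⟩
    · exact ⟨by linarith, h3⟩
  · rintro ⟨h1, h2⟩
    rcases lt_or_ge ((a : ℤ) + b) (q ^ 3 - 1) with h | h
    · exact Or.inl ⟨h, h1⟩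
    · exact Or.inr ⟨h, by lia, h2⟩

/-- For `q ≥ 2` and `0 ≤ b ≤ q`, the arithmetic jump set of Theorem 6.1
specialized to the Hermitian parameters `m = q+1`, `r = q` (so `r̃ = q` and
`g = q(q-1)/2`), `n = q³-1`, coincides with the Homma–Kim set `T(q,b)`. -/
theorem stmt3 (q b : ℕ) (hq : 2 ≤ q) (hb : b ≤ q) :
    S (q + 1) q q (q * (q - 1) / 2) (q ^ 3 - 1) b = T q b := by
  have hq' : (2 : ℤ) ≤ q := by exact_mod_cast hq
  have hb' : (b : ℤ) ≤ q := by exact_mod_cast hb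
  have mem (t r : ℕ) (hr : r < q) := mem_S_hermitian_iff (b := b) (a := q * t + r) hq
  have low (t r : ℕ) (hr : r < q) := sub_one_mul_emod_le_iff (t := t) (r := r) hq'
    (Nat.cast_nonneg b) hb' (Nat.cast_nonneg t) (Nat.cast_nonneg r) (by exact_mod_cast hr)
  have upp (t r : ℕ) (hr : r < q) := lt_sub_one_mul_emod_iff (t := t) (r := r) hq'
    (Nat.cast_nonneg b) hb' (Nat.cast_nonneg r) (by exact_mod_cast hr)
  push_cast at mem
  ext a
  constructor
  · intro h
    have hr : a % q < q := Nat.mod_lt _ (by lia)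
    have ha : q * (a / q) + a % q = a := Nat.div_add_mod a q
    generalize a % q = r at *
    generalize a / q = t at *
    subst ha
    rw [mem t r hr, low t r hr, upp t r hr] at h
    rcases lt_or_ge r (q - 1) with hlt | hge
    · exact Or.inl ⟨t, r, by lia, by lia, by lia, rfl⟩
    · obtain rfl : r = q - 1 := by lia
      exact Or.inr ⟨t, by lia, by lia, rfl⟩
  · rintro (⟨t, r, h1, h2, h3, rfl⟩ | ⟨t, h1, h2, rfl⟩)
    · have hr : r < q := by lia
      rw [mem t r hr, low t r hr, upp t r hr]
      exact ⟨Or.inl ⟨h1, by lia⟩, Or.inl ⟨h1, h3⟩⟩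
    · have hr : q - 1 < q := by lia
      rw [mem t _ hr, low t _ hr, upp t _ hr]
      exact ⟨Or.inr ⟨by lia, h1⟩, Or.inr ⟨by lia, h2⟩⟩
end

section
/- Let q ≥ 2 be an integer, n = q³−1 and g = q(q−1)/2. Let b be a natural number with b ≤ n, and write b = θ(q+1)+ρ with θ, ρ natural numbers and 0 ≤ ρ ≤ q. Then the greatest element of S(q+1, q, n, b) equals n+2g−(θ+1)(q+1) if 1 ≤ ρ ≤ q, and equals n+2g−q−θ(q+1) if ρ = 0. -/
/-- With `m = q + 1` and `a + b = n + q(q-1) - d`, the residue of `q(a-n-1)` is `ρ + d - 1`. -/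
theorem hermitian_residue {q a b θ ρ n d : ℤ} (hb : b = θ * (q + 1) + ρ)
    (ha : a + b = n + q * (q - 1) - d) (h0 : 1 ≤ ρ + d) (h1 : ρ + d ≤ q + 1) :
    (q * (a - n - 1)) % (q + 1) = ρ + d - 1 := by
  have ha' : a = n + q * (q - 1) - d - (θ * (q + 1) + ρ) := by linarith
  have h : q * (a - n - 1)
      = (ρ + d - 1) + (q + 1) * (-(d + ρ) - q * θ + (q - 1) ^ 2) := by
    rw [ha']; ring
  rw [h, Int.add_mul_emod_self_left, Int.emod_eq_of_lt (by linarith) (by linarith)]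

/-- `d` is the distance of `a + b` below `n + 2g`: the elements of `S` lie at distance at least
`q + 1 - ρ` (or `q` if `ρ = 0`), and this distance is attained. -/
theorem isGreatest_hermitian {q b θ ρ n a : ℕ} {d : ℤ} (hq : 2 ≤ q) (hb : b = θ * (q + 1) + ρ)
    (hd : (1 ≤ ρ ∧ ρ ≤ q ∧ d = q + 1 - ρ) ∨ (ρ = 0 ∧ d = q))
    (ha : (a : ℤ) + b = n + q * ((q : ℤ) - 1) - d) :
    IsGreatest (S (q + 1) q q (q * (q - 1) / 2) n b) a := by
  have hg : 2 * ((q * (q - 1) / 2 : ℕ) : ℤ) = q * ((q : ℤ) - 1) := by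
    have h := Nat.mul_div_cancel' (Nat.even_mul_pred_self q).two_dvd
    rw [← Nat.cast_pred (by omega)]
    exact_mod_cast h
  have hbz : (b : ℤ) = θ * ((q : ℤ) + 1) + ρ := by exact_mod_cast hb
  have hqz : (2 : ℤ) ≤ q := by exact_mod_cast hq
  have hdq : d ≤ q ∧ 1 ≤ d ∧ 1 ≤ ρ + d ∧ ρ + d ≤ (q : ℤ) + 1 := by omega
  obtain ⟨hdq, hd1, hl, hu⟩ := hdq
  simp only [S, IsGreatest, upperBounds, Set.mem_ofPred_eq, hg, Nat.cast_add, Nat.cast_one]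
  refine ⟨Or.inr ⟨by nlinarith, by linarith, ?_⟩, ?_⟩
  · rw [hermitian_residue hbz ha hl hu]
    rcases hd with ⟨_, _, rfl⟩ | ⟨rfl, rfl⟩
    · nlinarith
    · push_cast
      nlinarith
  · rintro x (⟨hx, -⟩ | ⟨-, hx, h⟩)
    · have : (x : ℤ) ≤ a := by nlinarith
      exact_mod_cast this
    · by_contra! hlt
      have hlt' : (a : ℤ) < x := by exact_mod_cast hlt
      obtain ⟨e, he⟩ : ∃ e : ℤ, (x : ℤ) + b = n + q * ((q : ℤ) - 1) - e :=
        ⟨n + q * ((q : ℤ) - 1) - (x + b), by ring⟩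
      have he1 : 1 ≤ e := by linarith
      have hed : e < d := by linarith
      rw [hermitian_residue hbz he (by omega) (by omega)] at h
      have hre : ρ + e ≤ (q : ℤ) ∧ e + 1 ≤ q ∧ (1 ≤ ρ ∨ ρ = 0) := by omega
      obtain ⟨h2, h3, h4⟩ := hre
      rcases h4 with h4 | rfl
      · nlinarith
      · push_cast at h
        nlinarith

/-- For the Hermitian parameters `m = q+1`, `r = q` (so `r̃ = q`,
`g = q(q-1)/2`) and `n = q³-1`, writing `b = θ(q+1)+ρ` with `0 ≤ ρ ≤ q`, the
greatest element of `S(q+1,q,n,b)` equals `n+2g-(θ+1)(q+1)` if `1 ≤ ρ ≤ q`,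
and `n+2g-q-θ(q+1)` if `ρ = 0`. Here `n+2g = q³-1+q(q-1)`. -/
theorem stmt5 (q b θ ρ : ℕ) (hq : 2 ≤ q) (hbn : b ≤ q ^ 3 - 1)
    (hb : b = θ * (q + 1) + ρ) (hρ : ρ ≤ q) :
    ∃ a : ℕ, IsGreatest (S (q + 1) q q (q * (q - 1) / 2) (q ^ 3 - 1) b) a ∧
      (1 ≤ ρ →
        (a : ℤ) = ((q : ℤ) ^ 3 - 1) + (q : ℤ) * ((q : ℤ) - 1)
          - ((θ : ℤ) + 1) * ((q : ℤ) + 1)) ∧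
      (ρ = 0 →
        (a : ℤ) = ((q : ℤ) ^ 3 - 1) + (q : ℤ) * ((q : ℤ) - 1)
          - q - (θ : ℤ) * ((q : ℤ) + 1)) := by
  have hq3 : ((q ^ 3 - 1 : ℕ) : ℤ) = (q : ℤ) ^ 3 - 1 := by
    rw [Nat.cast_pred (by positivity)]
    push_cast
    ring
  have hbz : (b : ℤ) = θ * ((q : ℤ) + 1) + ρ := by exact_mod_cast hb
  have hbn' : (b : ℤ) ≤ (q : ℤ) ^ 3 - 1 := by rw [← hq3]; exact_mod_cast hbn
  have hqz : (2 : ℤ) ≤ q := by exact_mod_cast hq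
  obtain ⟨d, hd⟩ : ∃ d : ℤ, (1 ≤ ρ ∧ ρ ≤ q ∧ d = q + 1 - ρ) ∨ (ρ = 0 ∧ d = q) := by
    rcases Nat.eq_zero_or_pos ρ with h | h
    · exact ⟨q, Or.inr ⟨h, rfl⟩⟩
    · exact ⟨q + 1 - ρ, Or.inl ⟨h, hρ, rfl⟩⟩
  have hdq : d ≤ q := by omega
  obtain ⟨a, ha⟩ : ∃ a : ℕ, (q : ℤ) ^ 3 - 1 + q * ((q : ℤ) - 1) - d - b = a :=
    Int.eq_ofNat_of_zero_le (by nlinarith)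
  refine ⟨a, isGreatest_hermitian hq hb hd (by rw [hq3]; linarith), fun h => ?_, fun h => ?_⟩
  · obtain rfl : d = q + 1 - ρ := by omega
    rw [← ha, hbz]
    ring
  · obtain rfl : d = q := by omega
    subst h
    rw [← ha, hbz]
    push_cast
    ring
end

section
/- Let m and r be coprime integers with 2 ≤ r ≤ m−1. Then there exist unique integers u and λ with 1 ≤ u ≤ m−1, 1 ≤ λ ≤ r−1 and λ·m = u·r + 1. Moreover, for these u and λ one has r·(m−u) ≡ 1 (mod m) and ⌊m/r⌋ = ⌊u/λ⌋. -/
/-- For coprime integers `m`, `r` with `2 ≤ r ≤ m-1`, there exist unique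
integers `u`, `λ` with `1 ≤ u ≤ m-1`, `1 ≤ λ ≤ r-1` and `λm = ur+1`;
moreover, for these `u` and `λ`, `r·(m-u) ≡ 1 (mod m)` and `⌊m/r⌋ = ⌊u/λ⌋`. -/
theorem stmt7 (m r : ℤ) (hr2 : 2 ≤ r) (hrm : r ≤ m - 1) (hco : IsCoprime m r) :
    (∃! p : ℤ × ℤ, 1 ≤ p.1 ∧ p.1 ≤ m - 1 ∧ 1 ≤ p.2 ∧ p.2 ≤ r - 1 ∧
      p.2 * m = p.1 * r + 1) ∧
    ∀ u l : ℤ, 1 ≤ u → u ≤ m - 1 → 1 ≤ l → l ≤ r - 1 → l * m = u * r + 1 →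
      (r * (m - u) ≡ 1 [ZMOD m] ∧ m / r = u / l) := by
  have hr : 0 < r := by linarith
  have hm : 0 < m := by linarith
  have not_dvd_one : ∀ c : ℤ, r * c ≠ 1 := fun c hc => by
    have := Int.le_of_dvd one_pos ⟨c, hc.symm⟩
    linarith
  refine ⟨?_, fun u l hu hum hl hlr h => ⟨?_, ?_⟩⟩
  · obtain ⟨a, b, hab⟩ := hco
    have hdiv := Int.emod_add_mul_ediv a r
    have hnonneg := Int.emod_nonneg a hr.ne'
    have hlt := Int.emod_lt_of_pos a hr
    set l := a % r
    set c := a / r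
    have key : l * m = -(b + c * m) * r + 1 := by
      linear_combination m * hdiv + hab
    have hl : 1 ≤ l := by
      rcases hnonneg.eq_or_lt with h0 | h0
      · refine absurd ?_ (not_dvd_one (b + c * m))
        rw [← h0] at key
        linear_combination key
      · exact h0
    refine ⟨(-(b + c * m), l), ⟨?_, ?_, hl, by simp only; linarith, key⟩, ?_⟩
    · have : 0 < -(b + c * m) * r := by nlinarith
      exact pos_of_mul_pos_left this hr.le
    · have : -(b + c * m) * r < m * r := by nlinarith
      exact Int.le_sub_one_of_lt (lt_of_mul_lt_mul_right this hr.le)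
    · rintro ⟨v, k⟩ ⟨-, -, hk, hkr, h⟩
      simp only at hk hkr h
      have hmr : IsCoprime r m := ⟨b, a, by linarith⟩
      have hd : r ∣ k - l := hmr.dvd_of_dvd_mul_right
        ⟨v + (b + c * m), by linear_combination h - key⟩
      have hkl : k = l := by
        have := Int.eq_zero_of_abs_lt_dvd hd (by rw [abs_lt]; constructor <;> linarith)
        linarith
      subst hkl
      have hv : v = -(b + c * m) := mul_right_cancel₀ hr.ne' (by linarith)
      rw [hv]
  · exact Int.modEq_iff_dvd.2 ⟨l - r, by linear_combination -h⟩
  · have hdiv := Int.emod_add_mul_ediv m r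
    have hnonneg := Int.emod_nonneg m hr.ne'
    have hlt := Int.emod_lt_of_pos m hr
    set s := m % r
    set q := m / r
    have hs : 1 ≤ s := by
      rcases hnonneg.eq_or_lt with h0 | h0
      · refine absurd ?_ (not_dvd_one (l * q - u))
        rw [← h0] at hdiv
        linear_combination h + l * hdiv
      · exact h0
    have key : u * r = q * l * r + (l * s - 1) := by
      linear_combination -h - l * hdiv
    symm
    rw [Int.ediv_eq_iff_of_pos (by linarith)]
    constructor
    · exact le_of_mul_le_mul_right (by nlinarith) hr
    · exact lt_of_mul_lt_mul_right (by nlinarith) hr.le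
end

section
/- Let m and r be coprime integers with 2 ≤ r ≤ m−1, and let r̃ be the unique integer with 1 ≤ r̃ ≤ m−1 and r·r̃ ≡ 1 (mod m). Let ρ and ℓ be integers with 0 ≤ ρ ≤ ⌊m/r⌋−1 and 1 ≤ ℓ ≤ (ρ+1)(r−1). Let μ be the unique integer with 0 ≤ μ ≤ m−1 and μ ≡ r̃·ℓ − ρ − 2 (mod m). Then (r−1)·μ ≤ (r−1)·(m−ρ−2) + ℓ − 1. -/
/-- Key exclusion estimate in the case `0 ≤ ρ < ⌊m/r⌋` of the proof of
Proposition 6.2: with `r̃` the inverse of `r` mod `m`, `0 ≤ ρ ≤ ⌊m/r⌋-1`,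
`1 ≤ ℓ ≤ (ρ+1)(r-1)`, and `μ` the residue of `r̃·ℓ-ρ-2` modulo `m`
(so `0 ≤ μ ≤ m-1`), one has `(r-1)·μ ≤ (r-1)·(m-ρ-2)+ℓ-1`. -/
theorem stmt9 (m r rt rho l mu : ℤ) (hr2 : 2 ≤ r) (hrm : r ≤ m - 1)
    (hco : IsCoprime m r)
    (hrt1 : 1 ≤ rt) (hrt2 : rt ≤ m - 1) (hrtinv : r * rt ≡ 1 [ZMOD m])
    (hrho0 : 0 ≤ rho) (hrho1 : rho ≤ m / r - 1)
    (hl1 : 1 ≤ l) (hl2 : l ≤ (rho + 1) * (r - 1))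
    (hmu0 : 0 ≤ mu) (hmu1 : mu ≤ m - 1) (hmu : mu ≡ rt * l - rho - 2 [ZMOD m]) :
    (r - 1) * mu ≤ (r - 1) * (m - rho - 2) + l - 1 := by
  by_contra! hlt
  obtain ⟨a, ha⟩ := hrtinv.dvd
  obtain ⟨b, hb⟩ := hmu.dvd
  obtain ⟨y, hy⟩ : ∃ y, y = mu + rho + 2 - m := ⟨_, rfl⟩
  have hly : l ≤ (r - 1) * y := by subst hy; linarith
  have hy_pos : 0 < y := by
    by_contra! h
    nlinarith
  have hy_le : y ≤ rho + 1 := by omega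
  have hrho : (rho + 1) * r ≤ m :=
    (Int.le_ediv_iff_mul_le (by omega)).mp (by omega)
  have hry : r * y ≤ m := by nlinarith
  have hdvd : m ∣ r * y - l :=
    ⟨-r * b - a * l - r, by subst hy; linear_combination (-r) * hb - l * ha⟩
  have hle := Int.le_of_dvd (by linarith) hdvd
  linarith
end

section
/- Let m and r be coprime integers with 2 ≤ r ≤ m−1, and let r̃ be the unique integer with 1 ≤ r̃ ≤ m−1 and r·r̃ ≡ 1 (mod m). Let ρ and ℓ be integers with ⌊m/r⌋ ≤ ρ ≤ m−1 and 1 ≤ ℓ ≤ m−1−ρ. Let μ be the unique integer with 0 ≤ μ ≤ m−1 and μ ≡ r̃·ℓ − 1 (mod m). Then (r−1)·μ ≤ (r−1)·(m−1) + ℓ − m + ρ. -/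
/-- Key exclusion estimate in the case `⌊m/r⌋ ≤ ρ ≤ m-1` of the proof of
Proposition 6.2: with `r̃` the inverse of `r` mod `m`, `⌊m/r⌋ ≤ ρ ≤ m-1`,
`1 ≤ ℓ ≤ m-1-ρ`, and `μ` the residue of `r̃·ℓ-1` modulo `m`
(so `0 ≤ μ ≤ m-1`), one has `(r-1)·μ ≤ (r-1)·(m-1)+ℓ-m+ρ`. -/
theorem stmt10 (m r rt rho l mu : ℤ) (hr2 : 2 ≤ r) (hrm : r ≤ m - 1)
    (hco : IsCoprime m r)
    (hrt1 : 1 ≤ rt) (hrt2 : rt ≤ m - 1) (hrtinv : r * rt ≡ 1 [ZMOD m])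
    (hrho0 : m / r ≤ rho) (hrho1 : rho ≤ m - 1)
    (hl1 : 1 ≤ l) (hl2 : l ≤ m - 1 - rho)
    (hmu0 : 0 ≤ mu) (hmu1 : mu ≤ m - 1) (hmu : mu ≡ rt * l - 1 [ZMOD m]) :
    (r - 1) * mu ≤ (r - 1) * (m - 1) + l - m + rho := by
  have hdvd : m ∣ r * (m - 1 - mu) + l := by
    obtain ⟨a, ha⟩ := hrtinv.dvd
    obtain ⟨b, hb⟩ := hmu.dvd
    exact ⟨r + r * b + l * a, by linear_combination l * ha + r * hb⟩
  obtain ⟨k, hk⟩ := hdvd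
  have hm : 0 < m := by linarith
  have hr : 0 < r := by linarith
  have ht : 0 ≤ r * (m - 1 - mu) := mul_nonneg hr.le (by linarith)
  have hk0 : 0 < k := pos_of_mul_pos_right (by linarith : 0 < m * k) hm.le
  have hrho : 0 ≤ rho := (Int.ediv_nonneg hm.le hr.le).trans hrho0
  obtain rfl | hk2 : k = 1 ∨ 2 ≤ k := by omega
  · have : m - 1 - mu ≤ m / r := (Int.le_ediv_iff_mul_le hr).2 (by linarith)
    linarith
  · have : m * 2 ≤ m * k := mul_le_mul_of_nonneg_left hk2 hm.le
    linarith
end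

section
/- Let m and r be coprime integers with 2 ≤ r ≤ m−1, set g = (m−1)(r−1)/2, and let n and b be natural numbers with n > 2g−1, n ≡ r−1 (mod m), and b ≤ n. Then the set S(m,r,n,b) contains an element a with a ≥ n−b. -/
/-- Arithmetic counterpart of Lemma 3.4(2) for Kummer extensions: the set
`S(m,r,n,b)` contains an element `a` with `a ≥ n-b`. -/
theorem stmt12 (m r rt g n b : ℕ)
    (hr2 : 2 ≤ r) (hrm : r ≤ m - 1) (hco : Nat.Coprime m r)
    (hg : 2 * g = (m - 1) * (r - 1))
    (hrt1 : 1 ≤ rt) (hrt2 : rt ≤ m - 1) (hrtinv : (r * rt) % m = 1)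
    (hn : 2 * (g : ℤ) - 1 < (n : ℤ)) (hnm : n % m = (r - 1) % m) (hb : b ≤ n) :
    ∃ a ∈ S m r rt g n b, (n : ℤ) - b ≤ (a : ℤ) := by
  have hm : 3 ≤ m := by omega
  have hg2 : 2 ≤ 2 * g := by
    rw [hg]
    exact (by omega : 2 ≤ 2 * 1).trans (Nat.mul_le_mul (by omega) (by omega))
  have hrt : 2 ≤ rt := by
    by_contra h
    obtain rfl : rt = 1 := by omega
    rw [mul_one, Nat.mod_eq_of_lt (by omega)] at hrtinv
    omega
  have hcop : IsCoprime (m : ℤ) (rt : ℤ) := by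
    refine ⟨-((r * rt / m : ℕ) : ℤ), r, ?_⟩
    have h : (m : ℤ) * ((r * rt / m : ℕ) : ℤ) + ((r * rt % m : ℕ) : ℤ) = (r : ℤ) * rt := by
      exact_mod_cast Nat.div_add_mod (r * rt) m
    rw [hrtinv] at h
    push_cast at h ⊢
    linarith
  by_cases hbm : (m : ℤ) ∣ (b : ℤ) + 1
  · refine ⟨n - b + 1, Or.inr ⟨by omega, by omega, ?_⟩, by omega⟩
    have hmod : ((rt : ℤ) * (((n - b + 1 : ℕ) : ℤ) - n - 1)) % m = rt := by
      obtain ⟨c, hc⟩ := hbm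
      have h : ((n - b + 1 : ℕ) : ℤ) - n - 1 = 1 + m * (-c) := by
        push_cast [hb]
        linarith
      rw [h, show (rt : ℤ) * (1 + m * (-c)) = rt + m * (rt * -c) by ring,
        Int.add_mul_emod_self_left]
      exact Int.emod_eq_of_lt (by omega) (by omega)
    rw [hmod]
    have h1 : ((n - b + 1 : ℕ) : ℤ) + b - n = 1 := by omega
    rw [h1]
    have hr : (1 : ℤ) ≤ (r : ℤ) - 1 := by omega
    have hrt' : (2 : ℤ) ≤ rt := by omega
    nlinarith
  · refine ⟨n - b, Or.inr ⟨by omega, by omega, ?_⟩, by omega⟩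
    have h0 : ((n - b : ℕ) : ℤ) + b - n = 0 := by omega
    rw [h0]
    have h : ((n - b : ℕ) : ℤ) - n - 1 = -((b : ℤ) + 1) := by omega
    rw [h]
    refine mul_pos (by omega) (lt_of_le_of_ne (Int.emod_nonneg _ (by omega)) fun h' => hbm ?_)
    exact (dvd_neg).1 (hcop.dvd_of_dvd_mul_left (Int.dvd_of_emod_eq_zero h'.symm))
end
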